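/- The presented group on three generators x₁, x₂, x₃ with relators x₁^2, x₁*u₁*x₃*u₁⁻¹ where u₁ = x₂⁻¹*x₁⁻¹*x₂*x₃⁻¹*x₂⁻¹, and x₂*u₂*x₃*u₂⁻¹ where u₂ = x₃*x₂⁻¹*x₁*x₂*x₁*x₂⁻¹*x₁⁻¹*x₂, is isomorphic to the presented group on three generators x₁, x₂, x₃ with relators x₁^2, x₁*w₁*x₃*w₁⁻¹ where w₁ = x₂*x₁⁻¹*x₂*x₃⁻¹*x₂⁻¹, and x₂*w₂*x₃*w₂⁻¹ where w₂ = x₃*x₂⁻¹*x₁*x₂⁻¹*x₁⁻¹*x₂*x₁⁻¹*x₂. (This is the step in Proposition 4.17 showing π₁(τ_{R(D(12n₅₅₆))}) ≅ π₁(τ_{R(D(12n₅₅₃))}), proved by the deformations α and β.) -/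

import Mathlib

/-- The generator `x₁` of the free group on three generators. -/
def x1 : FreeGroup (Fin 3) := FreeGroup.of 0

/-- The generator `x₂` of the free group on three generators. -/
def x2 : FreeGroup (Fin 3) := FreeGroup.of 1

/-- The generator `x₃` of the free group on three generators. -/
def x3 : FreeGroup (Fin 3) := FreeGroup.of 2

/-- The word `u₁ = x₂⁻¹x₁⁻¹x₂x₃⁻¹x₂⁻¹`. -/
def u1 : FreeGroup (Fin 3) := x2⁻¹ * x1⁻¹ * x2 * x3⁻¹ * x2⁻¹

/-- The word `u₂ = x₃x₂⁻¹x₁x₂x₁x₂⁻¹x₁⁻¹x₂`. -/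
def u2 : FreeGroup (Fin 3) := x3 * x2⁻¹ * x1 * x2 * x1 * x2⁻¹ * x1⁻¹ * x2

/-- The τ-presentation relators of `π₁(τ_{R(D(12n₅₅₆))})`. -/
def rels556 : Set (FreeGroup (Fin 3)) :=
  {x1 ^ 2, x1 * u1 * x3 * u1⁻¹, x2 * u2 * x3 * u2⁻¹}

/-- The word `w₁ = x₂x₁⁻¹x₂x₃⁻¹x₂⁻¹`. -/
def w1 : FreeGroup (Fin 3) := x2 * x1⁻¹ * x2 * x3⁻¹ * x2⁻¹

/-- The word `w₂ = x₃x₂⁻¹x₁x₂⁻¹x₁⁻¹x₂x₁⁻¹x₂`. -/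
def w2 : FreeGroup (Fin 3) := x3 * x2⁻¹ * x1 * x2⁻¹ * x1⁻¹ * x2 * x1⁻¹ * x2

/-- The τ-presentation relators of `π₁(τ_{R(D(12n₅₅₃))})`. -/
def rels553 : Set (FreeGroup (Fin 3)) :=
  {x1 ^ 2, x1 * w1 * x3 * w1⁻¹, x2 * w2 * x3 * w2⁻¹}

/-- If `a` squares to `1` and `a = u c⁻¹ u⁻¹`, then `c` squares to `1`. -/
theorem sq_eq_one_of_mul_conj_eq_one {G : Type*} [Group G] {a c u : G} (ha : a ^ 2 = 1)
    (h : a * u * c * u⁻¹ = 1) : c ^ 2 = 1 := by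
  have hc : a⁻¹ = u * c * u⁻¹ := inv_eq_of_mul_eq_one_right (by simpa only [mul_assoc] using h)
  rw [← conj_eq_one_iff (a := u), ← conj_pow, ← hc, inv_pow, ha, inv_one]

/-- A subgroup containing `x₁²` and the relators `x₁ux₃u⁻¹` and `x₂vx₃v⁻¹` makes every generator
an involution in the quotient. -/
theorem mk_inv_eq_self {N : Subgroup (FreeGroup (Fin 3))} [N.Normal] {u v : FreeGroup (Fin 3)}
    (h : {x1 ^ 2, x1 * u * x3 * u⁻¹, x2 * v * x3 * v⁻¹} ⊆ (N : Set (FreeGroup (Fin 3)))) :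
    (x1 : FreeGroup (Fin 3) ⧸ N)⁻¹ = x1 ∧ (x2 : FreeGroup (Fin 3) ⧸ N)⁻¹ = x2 ∧
      (x3 : FreeGroup (Fin 3) ⧸ N)⁻¹ = x3 := by
  simp only [Set.insert_subset_iff, Set.singleton_subset_iff, SetLike.mem_coe,
    ← QuotientGroup.eq_one_iff, QuotientGroup.mk_mul, QuotientGroup.mk_pow,
    QuotientGroup.mk_inv] at h
  obtain ⟨h1, h13, h23⟩ := h
  have h3 := sq_eq_one_of_mul_conj_eq_one h1 h13
  have h2 : (x2 : FreeGroup (Fin 3) ⧸ N) ^ 2 = 1 := by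
    have hb : (x2 : FreeGroup (Fin 3) ⧸ N) = (v * x3 * (v : FreeGroup (Fin 3) ⧸ N)⁻¹)⁻¹ :=
      eq_inv_of_mul_eq_one_left (by simpa only [mul_assoc] using h23)
    rw [hb, inv_pow, conj_pow, h3, mul_one, mul_inv_cancel, inv_one]
  simp only [pow_two] at h1 h2 h3
  exact ⟨inv_eq_of_mul_eq_one_right h1, inv_eq_of_mul_eq_one_right h2,
    inv_eq_of_mul_eq_one_right h3⟩

theorem mk_words_eq {N : Subgroup (FreeGroup (Fin 3))} [N.Normal]
    (h : (x1 : FreeGroup (Fin 3) ⧸ N)⁻¹ = x1 ∧ (x2 : FreeGroup (Fin 3) ⧸ N)⁻¹ = x2 ∧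
      (x3 : FreeGroup (Fin 3) ⧸ N)⁻¹ = x3) :
    (u1 : FreeGroup (Fin 3) ⧸ N) = w1 ∧ (u2 : FreeGroup (Fin 3) ⧸ N) = w2 := by
  obtain ⟨h1, h2, h3⟩ := h
  simp only [u1, u2, w1, w2, QuotientGroup.mk_mul, QuotientGroup.mk_inv, h1, h2, h3, and_self]

theorem rels556_subset_iff {N : Subgroup (FreeGroup (Fin 3))} [N.Normal] :
    rels556 ⊆ (N : Set (FreeGroup (Fin 3))) ↔ rels553 ⊆ (N : Set (FreeGroup (Fin 3))) := by
  have key (h : (u1 : FreeGroup (Fin 3) ⧸ N) = w1 ∧ (u2 : FreeGroup (Fin 3) ⧸ N) = w2) :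
      rels556 ⊆ (N : Set (FreeGroup (Fin 3))) ↔ rels553 ⊆ (N : Set (FreeGroup (Fin 3))) := by
    simp only [rels556, rels553, Set.insert_subset_iff, Set.singleton_subset_iff,
      SetLike.mem_coe, ← QuotientGroup.eq_one_iff, QuotientGroup.mk_mul, QuotientGroup.mk_inv,
      h.1, h.2]
  exact ⟨fun h => (key (mk_words_eq (mk_inv_eq_self h))).1 h,
    fun h => (key (mk_words_eq (mk_inv_eq_self h))).2 h⟩

theorem normalClosure_rels556 :
    Subgroup.normalClosure rels556 = Subgroup.normalClosure rels553 :=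
  le_antisymm
    (Subgroup.normalClosure_le_normal (rels556_subset_iff.2 Subgroup.subset_normalClosure))
    (Subgroup.normalClosure_le_normal (rels556_subset_iff.1 Subgroup.subset_normalClosure))

/-- `π₁(τ_{R(D(12n₅₅₆))}) ≅ π₁(τ_{R(D(12n₅₅₃))})`: the two τ-presentations give
isomorphic groups. -/
theorem stmt_9 : Nonempty (PresentedGroup rels556 ≃* PresentedGroup rels553) :=
  ⟨QuotientGroup.quotientMulEquivOfEq normalClosure_rels556⟩
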